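/- Let A be a commutative Noetherian ring and M a nonzero finitely generated A-module with Ass(M) = {p_1, …, p_n}, the p_i pairwise distinct, and assume p_i + p_j = A for all i ≠ j. For each i set M_i = ⋂_{j ≠ i} ker(M → M_{p_j}). If 0 = G_0 ⊆ G_1 ⊆ ⋯ ⊆ G_n = M is a coprimary filtration of M (with respect to some enumeration of Ass(M)) whose first term satisfies Ass(G_1) = {p_i}, then G_1 = M_i. -/

import Mathlib

/-- A coprimary filtration of `M` with respect to the enumeration `q 0, …, q (n-1)` of its
associated primes: a chain `0 = G 0 ⊆ G 1 ⊆ ⋯ ⊆ G n = M` with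
`Ass(G (i+1) / G i) = {q i}` for each `i`. -/
def IsCoprimaryFiltration {A : Type*} [CommRing A] {M : Type*} [AddCommGroup M] [Module A M]
    {n : ℕ} (q : Fin n → Ideal A) (G : Fin (n + 1) → Submodule A M) : Prop :=
  G 0 = ⊥ ∧ G (Fin.last n) = ⊤ ∧ Monotone G ∧
  ∀ i : Fin n,
    associatedPrimes A
      (↥(G i.succ) ⧸ Submodule.comap (G i.succ).subtype (G i.castSucc)) = {q i}

theorem mem_ker_mkLinearMap_iff_exists_smul_eq_zero
    {A : Type*} [CommRing A] {M : Type*} [AddCommGroup M] [Module A M]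
    (S : Submonoid A) (x : M) :
    x ∈ LinearMap.ker (LocalizedModule.mkLinearMap S M) ↔ ∃ s ∈ S, s • x = 0 := by
  rw [LinearMap.mem_ker, IsLocalizedModule.eq_zero_iff S]
  exact ⟨fun ⟨s, hs⟩ => ⟨s, s.2, hs⟩, fun ⟨s, hs, h⟩ => ⟨⟨s, hs⟩, h⟩⟩

/-- If `P` is the only associated prime of `M`, every element of `M` dies in the localization at
a prime not containing `P`. -/
theorem exists_smul_eq_zero_of_associatedPrimes_eq_singleton
    {A : Type*} [CommRing A] [IsNoetherianRing A] {M : Type*} [AddCommGroup M] [Module A M]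
    [Module.Finite A M] {P Q : Ideal A} [Q.IsPrime] (hM : associatedPrimes A M = {P})
    (hPQ : ¬ P ≤ Q) (x : M) : ∃ s ∈ Q.primeCompl, s • x = 0 := by
  by_contra! h
  have hle : Module.annihilator A M ≤ Q := fun a ha => by
    by_contra haQ
    exact h a haQ (Module.mem_annihilator.mp ha x)
  obtain ⟨P', hP', hP'Q⟩ := Ideal.exists_minimalPrimes_le hle
  have hmem := Module.associatedPrimes.minimalPrimes_annihilator_subset_associatedPrimes A M hP'
  rw [hM, Set.mem_singleton_iff] at hmem
  exact hPQ (hmem ▸ hP'Q)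

/-- If `Q` is the only associated prime of `M`, no nonzero element of `M` is killed by an element
outside `Q`. -/
theorem eq_zero_of_smul_eq_zero_of_associatedPrimes_eq_singleton
    {A : Type*} [CommRing A] [IsNoetherianRing A] {M : Type*} [AddCommGroup M] [Module A M]
    {Q : Ideal A} (hM : associatedPrimes A M = {Q}) {s : A} (hs : s ∉ Q) {x : M}
    (hx : s • x = 0) : x = 0 := by
  by_contra hne
  have hmem : s ∈ ⋃ P ∈ associatedPrimes A M, (P : Set A) := by
    rw [biUnion_associatedPrimes_eq_zero_divisors]
    exact ⟨x, hne, hx⟩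
  simp only [hM, Set.mem_singleton_iff, Set.iUnion_iUnion_eq_left] at hmem
  exact hs hmem

/-- Let `A` be a commutative Noetherian ring and `M` a nonzero finitely
generated `A`-module with `Ass(M) = {p 0, …, p (n-1)}`, the `p i` pairwise distinct and
pairwise comaximal, and set `Mᵢ = ⋂_{j ≠ i} ker (M → M_{p j})`.  If `0 = G₀ ⊆ ⋯ ⊆ Gₙ = M`
is a coprimary filtration of `M` (with respect to some enumeration `q` of `Ass(M)`) with
`Ass(G₁) = {p i}`, then `G₁ = Mᵢ`. -/
theorem coprimary_filtration_first_term_eq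
    {A : Type*} [CommRing A] [IsNoetherianRing A]
    {M : Type*} [AddCommGroup M] [Module A M] [Module.Finite A M] [Nontrivial M]
    {n : ℕ} (p : Fin n → Ideal A) (hprime : ∀ i, (p i).IsPrime)
    (hinj : Function.Injective p)
    (hAss : associatedPrimes A M = Set.range p)
    (hcomax : ∀ i j, i ≠ j → p i ⊔ p j = ⊤)
    (N : Fin n → Submodule A M)
    (hN : ∀ i, N i = ⨅ (j : Fin n) (_ : j ≠ i),
      LinearMap.ker (LocalizedModule.mkLinearMap
        (@Ideal.primeCompl A _ (p j) (hprime j)) M))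
    (q : Fin n → Ideal A)
    (hqinj : Function.Injective q) (hqAss : associatedPrimes A M = Set.range q)
    (hqorder : ∀ a b, q a < q b → b < a)
    (G : Fin (n + 1) → Submodule A M) (hG : IsCoprimaryFiltration q G)
    (i : Fin n) (hG1 : associatedPrimes A ↥(G 1) = {p i}) :
    G 1 = N i := by
  obtain ⟨hbot, htop, -, hquot⟩ := hG
  obtain _ | m := n
  · exact i.elim0
  have hq0 : q 0 = p i := by
    have h0 := hquot 0
    have hcomap : Submodule.comap (G (Fin.succ 0)).subtype (G (Fin.castSucc 0)) = ⊥ := by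
      rw [Fin.castSucc_zero, hbot, Submodule.comap_bot, Submodule.ker_subtype]
    rw [LinearEquiv.AssociatedPrimes.eq (Submodule.quotEquivOfEqBot _ hcomap)] at h0
    exact (Set.singleton_eq_singleton_iff.mp (hG1.symm.trans h0)).symm
  apply le_antisymm
  · rw [hN]
    refine le_iInf₂ fun j hj x hx => ?_
    have := hprime j
    have hle : ¬ p i ≤ p j := fun hle =>
      (hprime j).ne_top (by rw [← hcomax i j hj.symm, sup_eq_right.mpr hle])
    obtain ⟨s, hs, hsx⟩ :=
      exists_smul_eq_zero_of_associatedPrimes_eq_singleton hG1 hle (⟨x, hx⟩ : G 1)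
    exact (mem_ker_mkLinearMap_iff_exists_smul_eq_zero _ x).mpr
      ⟨s, hs, congrArg Subtype.val hsx⟩
  · have hstep : ∀ k : Fin (m + 1), N i ⊓ G k.succ ≤ G 1 := by
      intro k
      induction k using Fin.induction with
      | zero => exact inf_le_right
      | succ k ih =>
        rintro x ⟨hxN, hxG⟩
        refine ih ⟨hxN, ?_⟩
        obtain ⟨j, hj⟩ : q k.succ ∈ Set.range p := by
          rw [← hAss, hqAss]
          exact Set.mem_range_self _
        have hji : j ≠ i := fun h =>
          Fin.succ_ne_zero k (hqinj (by rw [hq0, ← hj, h]))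
        rw [SetLike.mem_coe, hN] at hxN
        simp only [Submodule.mem_iInf] at hxN
        have := hprime j
        obtain ⟨s, hs, hsx⟩ :=
          (mem_ker_mkLinearMap_iff_exists_smul_eq_zero _ x).mp (hxN j hji)
        have hzero := eq_zero_of_smul_eq_zero_of_associatedPrimes_eq_singleton
          (hquot k.succ) (s := s) (hj ▸ hs) (x := Submodule.Quotient.mk ⟨x, hxG⟩) (by
            rw [← Submodule.Quotient.mk_smul, Submodule.Quotient.mk_eq_zero]
            simp [hsx])
        simpa [Submodule.Quotient.mk_eq_zero] using hzero
    intro x hx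
    refine hstep (Fin.last m) ⟨hx, ?_⟩
    rw [Fin.succ_last, htop]
    trivial
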